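/- arXiv:2510.03609 — 4 statements merged into one kernel-verified Lean document; each statement's English description precedes it below -/
import Mathlib

section
/- Let n, m, p be positive integers and let z₁, z₂ : ℝ → EuclideanSpace ℝ (Fin n), u₁, u₂ : ℝ → EuclideanSpace ℝ (Fin m), y₁, y₂ : ℝ → EuclideanSpace ℝ (Fin p). Let V : ℝ → ℝ be differentiable on [0,∞), let α, ε > 0 and ρᵤ, ρ_y ≥ 0, and let Dᵤ, D_y ≥ 0 satisfy ‖u₁(s) - u₂(s)‖ ≤ Dᵤ and ‖y₁(s) - y₂(s)‖ ≤ D_y for all s ≥ 0. Assume that for all t ≥ 0: (i) V(t) ≥ ε·‖z₁(t) - z₂(t)‖², and (ii) V'(t) ≤ -α·V(t) + ρᵤ·‖u₁(t) - u₂(t)‖² + ρ_y·‖y₁(t) - y₂(t)‖². Then for all t ≥ 0, ‖z₁(t) - z₂(t)‖ ≤ √(V(0)/ε)·exp(-α t / 2) + √(ρᵤ/(ε α))·Dᵤ + √(ρ_y/(ε α))·D_y. -/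
/-- A scalar comparison principle: if `V' ≤ -α V + C` on `[0, ∞)` with `α > 0`, then
`V t - C / α` decays at least exponentially with rate `α`. -/
theorem sub_div_le_mul_exp_of_deriv_le {V V' : ℝ → ℝ} {α C : ℝ} (hα : 0 < α)
    (hderiv : ∀ t ∈ Set.Ici (0:ℝ), HasDerivWithinAt V (V' t) (Set.Ici 0) t)
    (hbound : ∀ t ≥ (0:ℝ), V' t ≤ -α * V t + C) {t : ℝ} (ht : 0 ≤ t) :
    V t - C / α ≤ (V 0 - C / α) * Real.exp (-(α * t)) := by
  have hW : ∀ s ∈ Set.Ici (0:ℝ), HasDerivWithinAt (fun s => (V s - C / α) * Real.exp (α * s))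
      (V' s * Real.exp (α * s) + (V s - C / α) * (Real.exp (α * s) * (α * 1))) (Set.Ici 0) s :=
    fun s hs => ((hderiv s hs).sub_const _).mul
      ((hasDerivWithinAt_id s _).const_mul α).exp
  have hanti : AntitoneOn (fun s => (V s - C / α) * Real.exp (α * s)) (Set.Ici 0) := by
    refine antitoneOn_of_hasDerivWithinAt_nonpos (convex_Ici 0)
      (fun s hs => (hW s hs).continuousWithinAt)
      (fun s hs => (hW s (interior_subset hs)).mono interior_subset) fun s hs => ?_
    have hb := hbound s (interior_subset hs)
    have hC : C / α * α = C := div_mul_cancel₀ C hα.ne'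
    have hfactor : V' s * Real.exp (α * s) + (V s - C / α) * (Real.exp (α * s) * (α * 1))
        = (V' s + α * V s - C / α * α) * Real.exp (α * s) := by ring
    rw [hfactor, hC]
    exact mul_nonpos_of_nonpos_of_nonneg (by linarith) (Real.exp_pos _).le
  have h := hanti (Set.mem_Ici.2 le_rfl) (Set.mem_Ici.2 ht) ht
  simp only [mul_zero, Real.exp_zero, mul_one] at h
  rwa [Real.exp_neg, ← div_eq_mul_inv, le_div_iff₀ (Real.exp_pos _)]

/-- Proposition 1: the δISS Lyapunov decrease condition with quadratic lower bound
yields explicit `L∞` gains from input/output disturbances to trajectory discrepancy. -/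
theorem deltaISS_disturbance_gain
    (n m p : ℕ) (hn : 0 < n) (hm : 0 < m) (hp : 0 < p)
    (z₁ z₂ : ℝ → EuclideanSpace ℝ (Fin n))
    (u₁ u₂ : ℝ → EuclideanSpace ℝ (Fin m))
    (y₁ y₂ : ℝ → EuclideanSpace ℝ (Fin p))
    (V V' : ℝ → ℝ)
    (hderiv : ∀ t ∈ Set.Ici (0:ℝ), HasDerivWithinAt V (V' t) (Set.Ici 0) t)
    (α ε ρu ρy Du Dy : ℝ)
    (hα : 0 < α) (hε : 0 < ε) (hρu : 0 ≤ ρu) (hρy : 0 ≤ ρy)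
    (hDu : 0 ≤ Du) (hDy : 0 ≤ Dy)
    (hu : ∀ s ≥ (0:ℝ), ‖u₁ s - u₂ s‖ ≤ Du)
    (hy : ∀ s ≥ (0:ℝ), ‖y₁ s - y₂ s‖ ≤ Dy)
    (hlb : ∀ t ≥ (0:ℝ), ε * ‖z₁ t - z₂ t‖ ^ 2 ≤ V t)
    (hdec : ∀ t ≥ (0:ℝ),
      V' t ≤ -α * V t + ρu * ‖u₁ t - u₂ t‖ ^ 2 + ρy * ‖y₁ t - y₂ t‖ ^ 2) :
    ∀ t ≥ (0:ℝ), ‖z₁ t - z₂ t‖ ≤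
      Real.sqrt (V 0 / ε) * Real.exp (-(α * t) / 2)
        + Real.sqrt (ρu / (ε * α)) * Du
        + Real.sqrt (ρy / (ε * α)) * Dy := by
  intro t ht
  have hV0 : 0 ≤ V 0 := le_trans (by positivity) (hlb 0 le_rfl)
  set C := ρu * Du ^ 2 + ρy * Dy ^ 2 with hC
  have hbound : ∀ s ≥ (0:ℝ), V' s ≤ -α * V s + C := by
    intro s hs
    have h₁ : ρu * ‖u₁ s - u₂ s‖ ^ 2 ≤ ρu * Du ^ 2 := by gcongr; exact hu s hs
    have h₂ : ρy * ‖y₁ s - y₂ s‖ ^ 2 ≤ ρy * Dy ^ 2 := by gcongr; exact hy s hs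
    linarith [hdec s hs]
  have hcomp := sub_div_le_mul_exp_of_deriv_le hα hderiv hbound ht
  have hVt : V t ≤ V 0 * Real.exp (-(α * t)) + C / α := by
    have : 0 ≤ C / α * Real.exp (-(α * t)) := by positivity
    linarith
  have hsq : ‖z₁ t - z₂ t‖ ^ 2 ≤ V 0 / ε * Real.exp (-(α * t))
      + ρu / (ε * α) * Du ^ 2 + ρy / (ε * α) * Dy ^ 2 := by
    have hdiv : ‖z₁ t - z₂ t‖ ^ 2 ≤ (V 0 * Real.exp (-(α * t)) + C / α) / ε := by
      rw [le_div_iff₀ hε]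
      linarith [hlb t ht]
    refine hdiv.trans_eq ?_
    rw [hC]
    field_simp
    ring
  have hexp : Real.exp (-(α * t) / 2) ^ 2 = Real.exp (-(α * t)) := by
    rw [← Real.exp_nat_mul]
    congr 1
    push_cast
    ring
  have ha : (Real.sqrt (V 0 / ε) * Real.exp (-(α * t) / 2)) ^ 2
      = V 0 / ε * Real.exp (-(α * t)) := by
    rw [mul_pow, Real.sq_sqrt (by positivity), hexp]
  have hb : (Real.sqrt (ρu / (ε * α)) * Du) ^ 2 = ρu / (ε * α) * Du ^ 2 := by
    rw [mul_pow, Real.sq_sqrt (by positivity)]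
  have hc : (Real.sqrt (ρy / (ε * α)) * Dy) ^ 2 = ρy / (ε * α) * Dy ^ 2 := by
    rw [mul_pow, Real.sq_sqrt (by positivity)]
  have ha₀ : 0 ≤ Real.sqrt (V 0 / ε) * Real.exp (-(α * t) / 2) := by positivity
  have hb₀ : 0 ≤ Real.sqrt (ρu / (ε * α)) * Du := by positivity
  have hc₀ : 0 ≤ Real.sqrt (ρy / (ε * α)) * Dy := by positivity
  rw [← ha, ← hb, ← hc] at hsq
  refine (sq_le_sq₀ (norm_nonneg _) (by positivity)).1 ?_
  nlinarith [mul_nonneg ha₀ hb₀, mul_nonneg ha₀ hc₀, mul_nonneg hb₀ hc₀]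
end

section
/- Let n, m, p, q be positive integers and let z₁, z₂ : ℝ → EuclideanSpace ℝ (Fin n), u₁, u₂ : ℝ → EuclideanSpace ℝ (Fin m), y₁, y₂ : ℝ → EuclideanSpace ℝ (Fin p), w₁, w₂ : ℝ → EuclideanSpace ℝ (Fin q). Let V : ℝ → ℝ be differentiable on [0,∞), let α, ε > 0 and ρᵤ, ρ_y, ρ_w ≥ 0, and let Dᵤ, D_y, D_w ≥ 0 satisfy ‖u₁(s)-u₂(s)‖ ≤ Dᵤ, ‖y₁(s)-y₂(s)‖ ≤ D_y, and ‖w₁(s)-w₂(s)‖ ≤ D_w for all s ≥ 0. Assume for all t ≥ 0: (i) V(t) ≥ ε·‖z₁(t)-z₂(t)‖², and (ii) V'(t) ≤ -α·V(t) + ρᵤ·‖u₁(t)-u₂(t)‖² + ρ_y·‖y₁(t)-y₂(t)‖² + ρ_w·‖w₁(t)-w₂(t)‖². Then for all t ≥ 0, ‖z₁(t)-z₂(t)‖ ≤ √(V(0)/ε)·exp(-α t/2) + √(ρᵤ/(ε α))·Dᵤ + √(ρ_y/(ε α))·D_y + √(ρ_w/(ε α))·D_w. -/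
/-- Exponential comparison: if `V' ≤ -α V + C` on `[0, ∞)` then `V` is bounded by the solution of
the corresponding linear equation. -/
theorem le_exp_decay_add_of_hasDerivWithinAt_le {V V' : ℝ → ℝ} {α C : ℝ} (hα : α ≠ 0)
    (hV : ∀ t ∈ Set.Ici (0 : ℝ), HasDerivWithinAt V (V' t) (Set.Ici 0) t)
    (hV' : ∀ t ≥ (0 : ℝ), V' t ≤ -α * V t + C) {t : ℝ} (ht : 0 ≤ t) :
    V t ≤ (V 0 - C / α) * Real.exp (-(α * t)) + C / α := by
  have hexp (s : ℝ) : HasDerivAt (fun x ↦ Real.exp (α * x)) (Real.exp (α * s) * α) s := by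
    simpa using ((hasDerivAt_id s).const_mul α).exp
  have hd (s : ℝ) (hs : s ∈ Set.Ici (0 : ℝ)) :=
    ((hV s hs).sub_const (C / α)).mul (hexp s).hasDerivWithinAt
  have hanti := antitoneOn_of_hasDerivWithinAt_nonpos (convex_Ici (0 : ℝ))
    (fun s hs ↦ (hd s hs).continuousWithinAt)
    (fun s hs ↦ (hd s (interior_subset hs)).mono interior_subset)
    (fun s hs ↦ by
      have h := hV' s (interior_subset hs)
      have hC : C / α * α = C := div_mul_cancel₀ C hα
      have hle : V' s + (V s - C / α) * α ≤ 0 := by linarith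
      calc _ = (V' s + (V s - C / α) * α) * Real.exp (α * s) := by ring
        _ ≤ 0 := mul_nonpos_of_nonpos_of_nonneg hle (Real.exp_pos _).le)
  have h := hanti Set.self_mem_Ici ht ht
  simp only [Pi.mul_apply, mul_zero, Real.exp_zero, mul_one] at h
  rw [← sub_le_iff_le_add, Real.exp_neg, ← div_eq_mul_inv, le_div_iff₀ (Real.exp_pos _)]
  exact h

/-- If `a²` is at most a sum of four squares of nonnegative reals, `a` is at most their sum. -/
theorem le_add_four_of_sq_le {a b c d e : ℝ} (hb : 0 ≤ b) (hc : 0 ≤ c) (hd : 0 ≤ d) (he : 0 ≤ e)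
    (h : a ^ 2 ≤ b ^ 2 + c ^ 2 + d ^ 2 + e ^ 2) : a ≤ b + c + d + e := by
  refine abs_le_of_sq_le_sq' (h.trans ?_) (by positivity) |>.2
  have : 0 ≤ 2 * (b * c + b * d + b * e + c * d + c * e + d * e) := by positivity
  linarith


/-- Three-input variant of Proposition 1, used for local observers of interconnected
subsystems: the extra interconnection term `ρ_w|w₁-w₂|²` yields the gain `√(ρ_w/(εα))`. -/
theorem deltaISS_disturbance_gain_interconnection
    (n m p q : ℕ) (hn : 0 < n) (hm : 0 < m) (hp : 0 < p) (hq : 0 < q)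
    (z₁ z₂ : ℝ → EuclideanSpace ℝ (Fin n))
    (u₁ u₂ : ℝ → EuclideanSpace ℝ (Fin m))
    (y₁ y₂ : ℝ → EuclideanSpace ℝ (Fin p))
    (w₁ w₂ : ℝ → EuclideanSpace ℝ (Fin q))
    (V V' : ℝ → ℝ)
    (hderiv : ∀ t ∈ Set.Ici (0:ℝ), HasDerivWithinAt V (V' t) (Set.Ici 0) t)
    (α ε ρu ρy ρw Du Dy Dw : ℝ)
    (hα : 0 < α) (hε : 0 < ε) (hρu : 0 ≤ ρu) (hρy : 0 ≤ ρy) (hρw : 0 ≤ ρw)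
    (hDu : 0 ≤ Du) (hDy : 0 ≤ Dy) (hDw : 0 ≤ Dw)
    (hu : ∀ s ≥ (0:ℝ), ‖u₁ s - u₂ s‖ ≤ Du)
    (hy : ∀ s ≥ (0:ℝ), ‖y₁ s - y₂ s‖ ≤ Dy)
    (hw : ∀ s ≥ (0:ℝ), ‖w₁ s - w₂ s‖ ≤ Dw)
    (hlb : ∀ t ≥ (0:ℝ), ε * ‖z₁ t - z₂ t‖ ^ 2 ≤ V t)
    (hdec : ∀ t ≥ (0:ℝ),
      V' t ≤ -α * V t + ρu * ‖u₁ t - u₂ t‖ ^ 2 + ρy * ‖y₁ t - y₂ t‖ ^ 2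
        + ρw * ‖w₁ t - w₂ t‖ ^ 2) :
    ∀ t ≥ (0:ℝ), ‖z₁ t - z₂ t‖ ≤
      Real.sqrt (V 0 / ε) * Real.exp (-(α * t) / 2)
        + Real.sqrt (ρu / (ε * α)) * Du
        + Real.sqrt (ρy / (ε * α)) * Dy
        + Real.sqrt (ρw / (ε * α)) * Dw := by
  intro t ht
  have hV0 : 0 ≤ V 0 := le_trans (by positivity) (hlb 0 le_rfl)
  have hbound : ∀ s ≥ (0 : ℝ),
      V' s ≤ -α * V s + (ρu * Du ^ 2 + ρy * Dy ^ 2 + ρw * Dw ^ 2) := fun s hs ↦ by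
    have h₁ : ρu * ‖u₁ s - u₂ s‖ ^ 2 ≤ ρu * Du ^ 2 := by gcongr; exact hu s hs
    have h₂ : ρy * ‖y₁ s - y₂ s‖ ^ 2 ≤ ρy * Dy ^ 2 := by gcongr; exact hy s hs
    have h₃ : ρw * ‖w₁ s - w₂ s‖ ^ 2 ≤ ρw * Dw ^ 2 := by gcongr; exact hw s hs
    linarith [hdec s hs]
  have hVt := le_exp_decay_add_of_hasDerivWithinAt_le hα.ne' hderiv hbound ht
  have hVt' : V t ≤ V 0 * Real.exp (-(α * t)) + (ρu * Du ^ 2 + ρy * Dy ^ 2 + ρw * Dw ^ 2) / α := by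
    have : 0 ≤ (ρu * Du ^ 2 + ρy * Dy ^ 2 + ρw * Dw ^ 2) / α * Real.exp (-(α * t)) := by
      positivity
    linarith
  refine le_add_four_of_sq_le (by positivity) (by positivity) (by positivity) (by positivity) ?_
  have hexp : Real.exp (-(α * t) / 2) ^ 2 = Real.exp (-(α * t)) := by
    rw [← Real.exp_nat_mul]; congr 1; push_cast; ring
  rw [mul_pow, mul_pow, mul_pow, mul_pow, Real.sq_sqrt (by positivity), Real.sq_sqrt (by positivity),
    Real.sq_sqrt (by positivity), Real.sq_sqrt (by positivity), hexp]
  calc ‖z₁ t - z₂ t‖ ^ 2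
      ≤ (V 0 * Real.exp (-(α * t)) + (ρu * Du ^ 2 + ρy * Dy ^ 2 + ρw * Dw ^ 2) / α) / ε := by
        rw [le_div_iff₀' hε]
        exact (hlb t ht).trans hVt'
    _ = _ := by field_simp; ring
end

section
/- Let c, n be positive integers, A : Matrix (Fin c) (Fin n) ℝ, and B : Matrix (Fin n) (Fin c) ℝ with A * B = 1 (B is a right inverse of A). Let w ∈ Fin n → ℝ and b₁, b₂ ∈ Fin c → ℝ with b₁ i ≤ b₂ i for all i. Define r ∈ Fin c → ℝ by r i := max(b₁ i - (A.mulVec w) i, 0) - max((A.mulVec w) i - b₂ i, 0), and set P := w + B.mulVec r. Then for all i, b₁ i ≤ (A.mulVec P) i ≤ b₂ i. -/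
/-- The HardNet affine projection layer: correcting `w` through a right inverse `B`
of the constraint matrix `A` enforces the two-sided affine constraints
`b₁ ≤ A P ≤ b₂` by construction whenever they are feasible. -/
theorem hardnet_affine_projection
    (c n : ℕ) (hc : 0 < c) (hn : 0 < n)
    (A : Matrix (Fin c) (Fin n) ℝ) (B : Matrix (Fin n) (Fin c) ℝ)
    (hAB : A * B = 1)
    (w : Fin n → ℝ) (b₁ b₂ : Fin c → ℝ) (hb : ∀ i, b₁ i ≤ b₂ i)
    (r : Fin c → ℝ)
    (hr : ∀ i, r i = max (b₁ i - A.mulVec w i) 0 - max (A.mulVec w i - b₂ i) 0)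
    (P : Fin n → ℝ) (hP : P = w + B.mulVec r) :
    ∀ i, b₁ i ≤ A.mulVec P i ∧ A.mulVec P i ≤ b₂ i := by
  intro i
  have hAP : A.mulVec P i = A.mulVec w i + r i := by
    rw [hP, Matrix.mulVec_add, Matrix.mulVec_mulVec, hAB, Matrix.one_mulVec, Pi.add_apply]
  have hbi := hb i
  rw [hAP, hr i]
  rcases max_cases (b₁ i - A.mulVec w i) 0 with ⟨h, _⟩ | ⟨h, _⟩ <;>
    rcases max_cases (A.mulVec w i - b₂ i) 0 with ⟨h', _⟩ | ⟨h', _⟩ <;>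
    rw [h, h'] <;> constructor <;> linarith
end

section
/- Let n, m, p be positive integers and let z₁, z₂ : ℝ → EuclideanSpace ℝ (Fin n), u₁, u₂ : ℝ → EuclideanSpace ℝ (Fin m), y₁, y₂ : ℝ → EuclideanSpace ℝ (Fin p). Let V : ℝ → ℝ be differentiable on [0,∞), let α, ε > 0, ρᵤ, ρ_y ≥ 0, M₁, M₂, Δ_{L₁}, Δ_{L₂} ≥ 0, and Dᵤ, D_y ≥ 0 with ‖u₁(s)-u₂(s)‖ ≤ Dᵤ and ‖y₁(s)-y₂(s)‖ ≤ D_y for all s ≥ 0. Assume for all t ≥ 0: (i) V(t) ≥ ε·‖z₁(t)-z₂(t)‖², and (ii) V'(t) ≤ -α·V(t) + ρᵤ·‖u₁(t)-u₂(t)‖² + ρ_y·‖y₁(t)-y₂(t)‖² + M₁·Δ_{L₁} + M₂·Δ_{L₂}. Then for all t ≥ 0, ‖z₁(t)-z₂(t)‖ ≤ √(V(0)/ε)·exp(-α t/2) + √(ρᵤ/(α ε))·Dᵤ + √(ρ_y/(α ε))·D_y + √((M₁Δ_{L₁} + M₂Δ_{L₂})/(α ε)). -/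
/-- A scalar function obeying `V' ≤ -α V + c` on `[0, ∞)` decays exponentially, up to an
additive offset `c / α`. -/
theorem le_exp_decay_add_of_deriv_le {V V' : ℝ → ℝ} {α c : ℝ} (hα : 0 < α) (hc : 0 ≤ c)
    (hderiv : ∀ t ∈ Set.Ici (0 : ℝ), HasDerivWithinAt V (V' t) (Set.Ici 0) t)
    (hdec : ∀ t ≥ (0 : ℝ), V' t ≤ -α * V t + c) {t : ℝ} (ht : 0 ≤ t) :
    V t ≤ V 0 * Real.exp (-(α * t)) + c / α := by
  have hg : ∀ s ∈ Set.Ici (0 : ℝ),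
      HasDerivWithinAt (fun s => Real.exp (α * s) * (V s - c / α))
        (Real.exp (α * s) * (α * V s - c + V' s)) (Set.Ici 0) s := by
    intro s hs
    have hexp : HasDerivWithinAt (fun s : ℝ => Real.exp (α * s))
        (Real.exp (α * s) * (α * 1)) (Set.Ici 0) s :=
      ((hasDerivAt_id s).const_mul α).exp.hasDerivWithinAt
    refine (hexp.mul ((hderiv s hs).sub_const (c / α))).congr_deriv ?_
    field_simp
  have hanti : AntitoneOn (fun s => Real.exp (α * s) * (V s - c / α)) (Set.Ici 0) := by
    refine antitoneOn_of_hasDerivWithinAt_nonpos (convex_Ici 0)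
      (fun s hs => (hg s hs).continuousWithinAt)
      (fun s hs => (hg s (interior_subset hs)).mono interior_subset) fun s hs => ?_
    have hs0 := hdec s (interior_subset hs)
    exact mul_nonpos_of_nonneg_of_nonpos (Real.exp_pos _).le (by linarith)
  have h := hanti Set.self_mem_Ici ht ht
  simp only [mul_zero, Real.exp_zero, one_mul] at h
  have hinv : Real.exp (-(α * t)) * Real.exp (α * t) = 1 := by
    rw [← Real.exp_add, neg_add_cancel, Real.exp_zero]
  have hle := mul_le_mul_of_nonneg_left h (Real.exp_pos (-(α * t))).le
  rw [← mul_assoc, hinv, one_mul] at hle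
  have : 0 ≤ Real.exp (-(α * t)) * (c / α) := by positivity
  linarith

theorem le_of_sq_le_sum_four_sq {x a b c d : ℝ} (ha : 0 ≤ a) (hb : 0 ≤ b) (hc : 0 ≤ c)
    (hd : 0 ≤ d) (h : x ^ 2 ≤ a ^ 2 + b ^ 2 + c ^ 2 + d ^ 2) : x ≤ a + b + c + d := by
  refine abs_le_of_sq_le_sq' (h.trans ?_) (by positivity) |>.2
  have : 0 ≤ 2 * (a * b + a * c + a * d + b * c + b * d + c * d) := by positivity
  linarith [show (a + b + c + d) ^ 2 = a ^ 2 + b ^ 2 + c ^ 2 + d ^ 2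
    + 2 * (a * b + a * c + a * d + b * c + b * d + c * d) by ring]

/-- Practical δISS of the learned observer (Remark 3): when the Lyapunov decrease
holds up to the consistency-error residual `M₁Δ_{L₁} + M₂Δ_{L₂}`, any two observer
trajectories satisfy an incremental ISS estimate with ultimate residual
`√((M₁Δ_{L₁}+M₂Δ_{L₂})/(αε))`. -/
theorem learned_observer_practical_deltaISS
    (n m p : ℕ) (hn : 0 < n) (hm : 0 < m) (hp : 0 < p)
    (z₁ z₂ : ℝ → EuclideanSpace ℝ (Fin n))
    (u₁ u₂ : ℝ → EuclideanSpace ℝ (Fin m))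
    (y₁ y₂ : ℝ → EuclideanSpace ℝ (Fin p))
    (V V' : ℝ → ℝ)
    (hderiv : ∀ t ∈ Set.Ici (0:ℝ), HasDerivWithinAt V (V' t) (Set.Ici 0) t)
    (α ε ρu ρy M₁ M₂ ΔL₁ ΔL₂ Du Dy : ℝ)
    (hα : 0 < α) (hε : 0 < ε) (hρu : 0 ≤ ρu) (hρy : 0 ≤ ρy)
    (hM₁ : 0 ≤ M₁) (hM₂ : 0 ≤ M₂) (hΔL₁ : 0 ≤ ΔL₁) (hΔL₂ : 0 ≤ ΔL₂)
    (hDu : 0 ≤ Du) (hDy : 0 ≤ Dy)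
    (hu : ∀ s ≥ (0:ℝ), ‖u₁ s - u₂ s‖ ≤ Du)
    (hy : ∀ s ≥ (0:ℝ), ‖y₁ s - y₂ s‖ ≤ Dy)
    (hlb : ∀ t ≥ (0:ℝ), ε * ‖z₁ t - z₂ t‖ ^ 2 ≤ V t)
    (hdec : ∀ t ≥ (0:ℝ),
      V' t ≤ -α * V t + ρu * ‖u₁ t - u₂ t‖ ^ 2 + ρy * ‖y₁ t - y₂ t‖ ^ 2
        + M₁ * ΔL₁ + M₂ * ΔL₂) :
    ∀ t ≥ (0:ℝ), ‖z₁ t - z₂ t‖ ≤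
      Real.sqrt (V 0 / ε) * Real.exp (-(α * t) / 2)
        + Real.sqrt (ρu / (α * ε)) * Du
        + Real.sqrt (ρy / (α * ε)) * Dy
        + Real.sqrt ((M₁ * ΔL₁ + M₂ * ΔL₂) / (α * ε)) := by
  intro t ht
  have hV0 : 0 ≤ V 0 := le_trans (by positivity) (hlb 0 le_rfl)
  have hV := le_exp_decay_add_of_deriv_le (V' := V')
    (c := ρu * Du ^ 2 + ρy * Dy ^ 2 + (M₁ * ΔL₁ + M₂ * ΔL₂)) hα (by positivity) hderiv
    (fun s hs => by
      have h₁ : ρu * ‖u₁ s - u₂ s‖ ^ 2 ≤ ρu * Du ^ 2 := by gcongr; exact hu s hs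
      have h₂ : ρy * ‖y₁ s - y₂ s‖ ^ 2 ≤ ρy * Dy ^ 2 := by gcongr; exact hy s hs
      linarith [hdec s hs]) ht
  have hz : ‖z₁ t - z₂ t‖ ^ 2 ≤ V 0 / ε * Real.exp (-(α * t)) + ρu / (α * ε) * Du ^ 2
      + ρy / (α * ε) * Dy ^ 2 + (M₁ * ΔL₁ + M₂ * ΔL₂) / (α * ε) := by
    calc ‖z₁ t - z₂ t‖ ^ 2 ≤ (V 0 * Real.exp (-(α * t))
          + (ρu * Du ^ 2 + ρy * Dy ^ 2 + (M₁ * ΔL₁ + M₂ * ΔL₂)) / α) / ε := by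
          rw [le_div_iff₀' hε]
          exact (hlb t ht).trans hV
      _ = _ := by field_simp; ring
  have hexp : Real.exp (-(α * t) / 2) ^ 2 = Real.exp (-(α * t)) := by
    rw [← Real.exp_nat_mul]
    congr 1
    push_cast
    ring
  have ha : (Real.sqrt (V 0 / ε) * Real.exp (-(α * t) / 2)) ^ 2
      = V 0 / ε * Real.exp (-(α * t)) := by
    rw [mul_pow, Real.sq_sqrt (by positivity), hexp]
  have hb : (Real.sqrt (ρu / (α * ε)) * Du) ^ 2 = ρu / (α * ε) * Du ^ 2 := by
    rw [mul_pow, Real.sq_sqrt (by positivity)]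
  have hc : (Real.sqrt (ρy / (α * ε)) * Dy) ^ 2 = ρy / (α * ε) * Dy ^ 2 := by
    rw [mul_pow, Real.sq_sqrt (by positivity)]
  have hd : Real.sqrt ((M₁ * ΔL₁ + M₂ * ΔL₂) / (α * ε)) ^ 2
      = (M₁ * ΔL₁ + M₂ * ΔL₂) / (α * ε) := Real.sq_sqrt (by positivity)
  rw [← ha, ← hb, ← hc, ← hd] at hz
  refine le_of_sq_le_sum_four_sq ?_ ?_ ?_ ?_ hz <;> positivity
end
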